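/- arXiv:0901.1871 — 2 statements merged into one kernel-verified Lean document; each statement's English description precedes it below -/
import Mathlib

section
/- For a measurable space (X, 𝒳), Assumption (A0) holds if and only if Assumption (A1) holds: that is, (for all measurable f, g : X → ℝ, (∀ x y, f(x) = f(y) ⟹ g(x) = g(y)) implies σ(g) ⊆ σ(f)) if and only if (any two countably generated sub-σ-algebras 𝒜₁, 𝒜₂ ⊆ 𝒳 with [x]_{𝒜₁} = [x]_{𝒜₂} for all x ∈ X are equal). -/
open MeasureTheory

/-- `σ(f)`: the σ-algebra `{f⁻¹(B) : B ⊆ ℝ Borel}` generated by a real-valued function. -/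
def sigmaOf {X : Type*} (f : X → ℝ) : MeasurableSpace X :=
  MeasurableSpace.comap f Real.measurableSpace

/-- Assumption (A0): `(X,𝒳)` is a weakly Blackwell space. -/
def WeaklyBlackwell {X : Type*} (𝒳 : MeasurableSpace X) : Prop :=
  ∀ f g : X → ℝ, Measurable[𝒳] f → Measurable[𝒳] g →
    (∀ x y : X, f x = f y → g x = g y) → sigmaOf g ≤ sigmaOf f

/-- The atom of `x` in a sub-σ-algebra `𝒜`. -/
def atom {X : Type*} (𝒜 : MeasurableSpace X) (x : X) : Set X :=
  ⋂₀ {A : Set X | MeasurableSet[𝒜] A ∧ x ∈ A}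

theorem mem_atom_comap {X Y : Type*} [MeasurableSpace Y] [MeasurableSingletonClass Y]
    (f : X → Y) (x y : X) :
    y ∈ atom (MeasurableSpace.comap f inferInstance) x ↔ f y = f x := by
  constructor
  · intro h
    exact h (f ⁻¹' {f x}) ⟨⟨{f x}, measurableSet_singleton _, rfl⟩, rfl⟩
  · rintro h _ ⟨⟨B, -, rfl⟩, hx⟩
    rw [Set.mem_preimage] at hx ⊢
    rwa [h]

/-- A countably generated σ-algebra is generated by one real-valued function. -/
theorem exists_eq_sigmaOf {X : Type*} (m : MeasurableSpace X)
    (hm : @MeasurableSpace.CountablyGenerated X m) : ∃ f : X → ℝ, m = sigmaOf f := by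
  refine ⟨embeddingReal (ℕ → Bool) ∘ MeasurableSpace.mapNatBool X, ?_⟩
  rw [sigmaOf, ← MeasurableSpace.comap_comp]
  have h : MeasurableSpace.comap (embeddingReal (ℕ → Bool)) Real.measurableSpace =
      MeasurableSpace.pi := (measurableEmbedding_embeddingReal (ℕ → Bool)).comap_eq
  rw [h]
  apply le_antisymm
  · conv_lhs => rw [← MeasurableSpace.generateFrom_natGeneratingSequence X]
    refine MeasurableSpace.generateFrom_le ?_
    rintro _ ⟨n, rfl⟩
    refine ⟨(fun u : ℕ → Bool => u n) ⁻¹' {true},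
      measurable_pi_apply n (measurableSet_singleton true), ?_⟩
    ext x
    simp [MeasurableSpace.mapNatBool]
  · exact (MeasurableSpace.measurable_mapNatBool X).comap_le

/-- **Lemma.** Assumption (A0) holds for `(X,𝒳)` iff Assumption (A1) holds: two countably
generated sub-σ-algebras of `𝒳` with the same atoms are equal. -/
theorem weaklyBlackwell_iff_A1 {X : Type*} (𝒳 : MeasurableSpace X) :
    WeaklyBlackwell 𝒳 ↔
      ∀ 𝒜₁ 𝒜₂ : MeasurableSpace X, 𝒜₁ ≤ 𝒳 → 𝒜₂ ≤ 𝒳 →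
        @MeasurableSpace.CountablyGenerated X 𝒜₁ →
        @MeasurableSpace.CountablyGenerated X 𝒜₂ →
        (∀ x : X, atom 𝒜₁ x = atom 𝒜₂ x) → 𝒜₁ = 𝒜₂ := by
  constructor
  · intro h 𝒜₁ 𝒜₂ h₁ h₂ c₁ c₂ hatom
    obtain ⟨f, rfl⟩ := exists_eq_sigmaOf 𝒜₁ c₁
    obtain ⟨g, rfl⟩ := exists_eq_sigmaOf 𝒜₂ c₂
    have hf : Measurable[𝒳] f := measurable_iff_comap_le.2 h₁
    have hg : Measurable[𝒳] g := measurable_iff_comap_le.2 h₂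
    have key : ∀ x y, f x = f y ↔ g x = g y := fun x y => by
      have := hatom y
      rw [← mem_atom_comap f, ← mem_atom_comap g]
      exact Set.ext_iff.1 this x
    exact le_antisymm (h g f hg hf fun x y => (key x y).2)
      (h f g hf hg fun x y => (key x y).1)
  · intro h f g hf hg hfg
    have hsup : sigmaOf f ⊔ sigmaOf g =
        MeasurableSpace.comap (fun x => (f x, g x)) inferInstance :=
      (MeasurableSpace.comap_prodMk f g).symm
    have cf : @MeasurableSpace.CountablyGenerated X (sigmaOf f) := .comap f
    have cg : @MeasurableSpace.CountablyGenerated X (sigmaOf g) := .comap g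
    have hle : sigmaOf f ⊔ sigmaOf g ≤ 𝒳 := sup_le hf.comap_le hg.comap_le
    have heq : sigmaOf f = sigmaOf f ⊔ sigmaOf g := by
      refine h _ _ hf.comap_le hle cf (cf.sup cg) fun x => ?_
      ext y
      rw [hsup, mem_atom_comap, Prod.mk.injEq]
      exact (mem_atom_comap f x y).trans ⟨fun e => ⟨e, hfg y x e⟩, And.left⟩
    rw [heq]
    exact le_sup_right
end

section
/- Let X be an uncountable set and 𝒳 = {A ⊆ X : A is countable or X∖A is countable} the countable–cocountable σ-algebra on X. Then: (i) 𝒳 is not countably generated; (ii) every countably generated sub-σ-algebra 𝒜 ⊆ 𝒳 has at most countably many atoms; and (iii) (X, 𝒳) satisfies Assumption (A0) (it is a weakly Blackwell space, although it is not a Blackwell space). -/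
open MeasureTheory

/-- The countable–cocountable σ-algebra on `X`:
`𝒳 = {A ⊆ X : A countable or X∖A countable}`. -/
def cocountableAlgebra (X : Type*) : MeasurableSpace X where
  MeasurableSet' A := A.Countable ∨ Aᶜ.Countable
  measurableSet_empty := Or.inl Set.countable_empty
  measurableSet_compl A h := by
    rcases h with h | h
    · exact Or.inr (by simpa using h)
    · exact Or.inl h
  measurableSet_iUnion f h := by
    by_cases hc : ∀ i, (f i).Countable
    · exact Or.inl (Set.countable_iUnion hc)
    · push_neg at hc
      obtain ⟨i, hi⟩ := hc
      rcases h i with h' | h'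
      · exact absurd h' hi
      · refine Or.inr (h'.mono ?_)
        rw [Set.compl_iUnion]
        exact Set.iInter_subset _ i

/-- A countably generated σ-algebra of countable and cocountable sets does not separate the points
lying outside some countable set. -/
theorem exists_countable_forall_notMem_mem_iff {X : Type*} {𝒜 : MeasurableSpace X}
    (h𝒜 : 𝒜 ≤ cocountableAlgebra X) (hg : @MeasurableSpace.CountablyGenerated X 𝒜) :
    ∃ C : Set X, C.Countable ∧
      ∀ x ∉ C, ∀ y ∉ C, ∀ A : Set X, MeasurableSet[𝒜] A → (x ∈ A ↔ y ∈ A) := by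
  classical
  obtain ⟨b, hb, rfl⟩ := hg.isCountablyGenerated
  have hb_alt : ∀ s ∈ b, s.Countable ∨ sᶜ.Countable := fun s hs ↦
    h𝒜 s (MeasurableSpace.measurableSet_generateFrom hs)
  refine ⟨⋃ s ∈ b, if s.Countable then s else sᶜ, hb.biUnion fun s hs ↦ ?_, ?_⟩
  · split_ifs with h
    · exact h
    · exact (hb_alt s hs).resolve_left h
  intro x hx y hy A hA
  simp only [Set.mem_iUnion, not_exists] at hx hy
  induction A, hA using MeasurableSpace.generateFrom_induction with
  | hC s hs _ =>
    have hxs := hx s hs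
    have hys := hy s hs
    split_ifs at hxs hys
    · exact iff_of_false hxs hys
    · exact iff_of_true (not_not.mp hxs) (not_not.mp hys)
  | empty => rfl
  | compl t _ ih => exact not_congr ih
  | iUnion s _ ih => simp only [Set.mem_iUnion, ih]

theorem atom_congr {X : Type*} {𝒜 : MeasurableSpace X} {x y : X}
    (h : ∀ A : Set X, MeasurableSet[𝒜] A → (x ∈ A ↔ y ∈ A)) : atom 𝒜 x = atom 𝒜 y := by
  unfold atom
  congr 1
  ext A
  exact and_congr_right fun hA ↦ h A hA

/-- A function that is constant off a countable set has countable range. -/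
theorem Set.Countable.countable_range_of_eq_off {X Y : Type*} {C : Set X} (hC : C.Countable)
    {F : X → Y} (hF : ∀ x ∉ C, ∀ y ∉ C, F x = F y) : (Set.range F).Countable := by
  rw [← Set.image_univ, ← Set.union_compl_self C, Set.image_union]
  refine (hC.image F).union (Set.Subsingleton.countable ?_)
  rintro _ ⟨x, hx, rfl⟩ _ ⟨y, hy, rfl⟩
  exact hF x hx y hy

theorem not_countablyGenerated_cocountableAlgebra {X : Type*} (hX : ¬ Countable X) :
    ¬ @MeasurableSpace.CountablyGenerated X (cocountableAlgebra X) := by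
  intro hg
  obtain ⟨C, hC, h⟩ := exists_countable_forall_notMem_mem_iff le_rfl hg
  have hid : ∀ x ∉ C, ∀ y ∉ C, id x = id y := fun x hx y hy ↦
    ((h x hx y hy {x} (Or.inl (Set.countable_singleton x))).mp rfl).symm
  have hrange := hC.countable_range_of_eq_off hid
  rw [Set.range_id] at hrange
  exact hX (Set.countable_univ_iff.mp hrange)

theorem countable_range_atom {X : Type*} {𝒜 : MeasurableSpace X}
    (h𝒜 : 𝒜 ≤ cocountableAlgebra X) (hg : @MeasurableSpace.CountablyGenerated X 𝒜) :
    (Set.range fun x : X => atom 𝒜 x).Countable := by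
  obtain ⟨C, hC, h⟩ := exists_countable_forall_notMem_mem_iff h𝒜 hg
  exact hC.countable_range_of_eq_off fun x hx y hy ↦ atom_congr (h x hx y hy)

theorem countable_range_of_measurable_cocountableAlgebra {X : Type*} {f : X → ℝ}
    (hf : Measurable[cocountableAlgebra X] f) : (Set.range f).Countable := by
  obtain ⟨C, hC, h⟩ := exists_countable_forall_notMem_mem_iff (𝒜 := sigmaOf f) hf.comap_le
    (MeasurableSpace.CountablyGenerated.comap f)
  exact hC.countable_range_of_eq_off fun x hx y hy ↦
    ((h x hx y hy (f ⁻¹' {f x}) ⟨{f x}, measurableSet_singleton _, rfl⟩).mp rfl).symm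

/-- A function with countable range generates every function that factors through it. -/
theorem sigmaOf_le_of_countable_range {X : Type*} {f g : X → ℝ} (hf : (Set.range f).Countable)
    (hfg : ∀ x y : X, f x = f y → g x = g y) : sigmaOf g ≤ sigmaOf f := by
  rintro _ ⟨B, -, rfl⟩
  refine ⟨f '' (g ⁻¹' B), (hf.mono (Set.image_subset_range _ _)).measurableSet, ?_⟩
  refine Set.Subset.antisymm ?_ (Set.subset_preimage_image _ _)
  rintro x ⟨y, hy, hyx⟩
  simpa only [Set.mem_preimage, hfg y x hyx] using hy

/-- **Example.** For `X` uncountable and `𝒳` the countable–cocountable σ-algebra: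
(i) `𝒳` is not countably generated; (ii) every countably generated sub-σ-algebra of `𝒳`
has at most countably many atoms; (iii) `(X,𝒳)` satisfies (A0), i.e. it is a weakly
Blackwell space. -/
theorem cocountable_weaklyBlackwell {X : Type*} (hX : ¬ Countable X) :
    (¬ @MeasurableSpace.CountablyGenerated X (cocountableAlgebra X)) ∧
      (∀ 𝒜 : MeasurableSpace X, 𝒜 ≤ cocountableAlgebra X →
        @MeasurableSpace.CountablyGenerated X 𝒜 →
        (Set.range fun x : X => atom 𝒜 x).Countable) ∧
      WeaklyBlackwell (cocountableAlgebra X) := by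
  exact ⟨not_countablyGenerated_cocountableAlgebra hX, fun _ ↦ countable_range_atom,
    fun _ _ hf _ hfg ↦
      sigmaOf_le_of_countable_range (countable_range_of_measurable_cocountableAlgebra hf) hfg⟩
end
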